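/- Let H = (V, E) be a finite hypergraph, k a natural number, and let U_k = {u ∈ V : K(u) ≥ k} be the set of nodes with quark number at least k. Then the minimum degree of the induced hypergraph H|_{U_k} is at least k, and the k-quarks of H are exactly the connectivity components of H|_{U_k} (the maximal subsets of U_k whose induced hypergraph is connected). Hence the k-quarks can be constructed from the quark numbers alone. -/

import Mathlib

variable {V : Type*}

/-- Degree of node `v` in the hypergraph with hyperedge set `E` induced on `S`:
the number of hyperedges contained in `S` that contain `v`. -/
def hdeg [DecidableEq V] (E : Finset (Finset V)) (S : Finset V) (v : V) : ℕ :=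
  (E.filter fun e => v ∈ e ∧ e ⊆ S).card

/-- Nodes `u` and `v` are connected in the hypergraph induced on `S`:
there is a nonempty sequence of hyperedges of `H|_S` starting at an edge containing `u`,
ending at an edge containing `v`, with consecutive edges intersecting. -/
def HConn [DecidableEq V] (E : Finset (Finset V)) (S : Finset V) (u v : V) : Prop :=
  ∃ (l : List (Finset V)) (hl : l ≠ []),
    (∀ e ∈ l, e ∈ E ∧ e ⊆ S) ∧ u ∈ l.head hl ∧ v ∈ l.getLast hl ∧
    l.Chain' fun e f => (e ∩ f).Nonempty

/-- The hypergraph induced on `S` is connected. -/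
def ConnectedOn [DecidableEq V] (E : Finset (Finset V)) (S : Finset V) : Prop :=
  ∀ u ∈ S, ∀ v ∈ S, HConn E S u v

/-- `S` is a `k`-quark: the induced hypergraph is connected, has minimum degree at least `k`,
and `S` is maximal with these two properties. -/
def IsQuark [DecidableEq V] (E : Finset (Finset V)) (k : ℕ) (S : Finset V) : Prop :=
  ConnectedOn E S ∧ (∀ v ∈ S, k ≤ hdeg E S v) ∧
    ∀ T : Finset V, S ⊆ T → ConnectedOn E T → (∀ v ∈ T, k ≤ hdeg E T v) → T = S

/-- The quark number of `u`: the largest `k` such that `u` belongs to a nonempty `k`-quark. -/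
noncomputable def quarkNum [DecidableEq V] (E : Finset (Finset V)) (u : V) : ℕ :=
  sSup {k : ℕ | ∃ S : Finset V, IsQuark E k S ∧ u ∈ S}

section Hypergraph

variable [DecidableEq V] {E : Finset (Finset V)} {S T : Finset V}

theorem HConn.symm {u v : V} (h : HConn E S u v) : HConn E S v u := by
  obtain ⟨l, hl, hE, hu, hv, hc⟩ := h
  refine ⟨l.reverse, by simpa using hl, by simpa using hE, by simpa using hv, by simpa using hu, ?_⟩
  refine List.isChain_reverse.2 (List.IsChain.imp (fun a b h => ?_) hc)
  rwa [Finset.inter_comm] at h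

theorem HConn.trans {u v w : V} (h₁ : HConn E S u v) (h₂ : HConn E S v w) : HConn E S u w := by
  obtain ⟨l, hl, hE, hu, hv, hc⟩ := h₁
  obtain ⟨m, hm, hE', hv', hw, hc'⟩ := h₂
  refine ⟨l ++ m, by simp [hl], ?_, ?_, ?_, ?_⟩
  · intro e he
    exact (List.mem_append.1 he).elim (hE e) (hE' e)
  · rwa [List.head_append_of_ne_nil hl]
  · rwa [List.getLast_append_of_ne_nil _ hm]
  · refine List.isChain_append.2 ⟨hc, hc', fun x hx y hy => ⟨v, ?_⟩⟩
    rw [List.getLast?_eq_getLast_of_ne_nil hl, Option.mem_some_iff] at hx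
    rw [List.head?_eq_some_head hm, Option.mem_some_iff] at hy
    subst hx hy
    exact Finset.mem_inter.2 ⟨hv, hv'⟩

theorem HConn.mono {u v : V} (hST : S ⊆ T) (h : HConn E S u v) : HConn E T u v := by
  obtain ⟨l, hl, hE, h⟩ := h
  exact ⟨l, hl, fun e he => ⟨(hE e he).1, (hE e he).2.trans hST⟩, h⟩

theorem hdeg_mono (hST : S ⊆ T) (v : V) : hdeg E S v ≤ hdeg E T v :=
  Finset.card_le_card <| Finset.monotone_filter_right E fun _ _ h => ⟨h.1, h.2.trans hST⟩

/-- Attaching to each node of a connected set a connected set through that node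
gives a connected set. -/
theorem ConnectedOn.biUnion {P : V → Finset V} (hT : ConnectedOn E T)
    (hmem : ∀ t ∈ T, t ∈ P t) (hP : ∀ t ∈ T, ConnectedOn E (P t)) :
    ConnectedOn E (T.biUnion P) := by
  have hsub : T ⊆ T.biUnion P := fun t ht => Finset.mem_biUnion.2 ⟨t, ht, hmem t ht⟩
  intro u hu v hv
  obtain ⟨s, hs, hus⟩ := Finset.mem_biUnion.1 hu
  obtain ⟨t, ht, hvt⟩ := Finset.mem_biUnion.1 hv
  exact ((hP s hs u hus s (hmem s hs)).mono (Finset.subset_biUnion_of_mem P hs)).trans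
    (((hT s hs t ht).mono hsub).trans
      ((hP t ht t (hmem t ht) v hvt).mono (Finset.subset_biUnion_of_mem P ht)))

theorem bddAbove_quark (E : Finset (Finset V)) (u : V) :
    BddAbove {k : ℕ | ∃ S : Finset V, IsQuark E k S ∧ u ∈ S} := by
  refine ⟨E.card, ?_⟩
  rintro k ⟨S, hS, hu⟩
  exact (hS.2.1 u hu).trans (Finset.card_filter_le _ _)

theorem IsQuark.le_quarkNum {k : ℕ} {u : V} (hS : IsQuark E k S) (hu : u ∈ S) :
    k ≤ quarkNum E u :=
  le_csSup (bddAbove_quark E u) ⟨S, hS, hu⟩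

theorem exists_isQuark_quarkNum {u : V} (h : quarkNum E u ≠ 0) :
    ∃ S : Finset V, IsQuark E (quarkNum E u) S ∧ u ∈ S := by
  refine Nat.sSup_mem (s := {k : ℕ | ∃ S : Finset V, IsQuark E k S ∧ u ∈ S}) ?_
    (bddAbove_quark E u)
  by_contra hne
  rw [Set.not_nonempty_iff_eq_empty] at hne
  exact h (by rw [quarkNum, hne, csSup_empty, Nat.bot_eq_zero])

theorem exists_isQuark_superset [Fintype V] {k : ℕ} (hS : ConnectedOn E S)
    (hd : ∀ v ∈ S, k ≤ hdeg E S v) : ∃ Q, S ⊆ Q ∧ IsQuark E k Q := by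
  obtain ⟨Q, hSQ, hQ⟩ := (Set.toFinite
    {T : Finset V | ConnectedOn E T ∧ ∀ v ∈ T, k ≤ hdeg E T v}).exists_le_maximal ⟨hS, hd⟩
  exact ⟨Q, hSQ, hQ.prop.1, hQ.prop.2, fun T hQT hT hdT =>
    (hQ.eq_of_le ⟨hT, hdT⟩ hQT).symm⟩

end Hypergraph

/-- if `U` is the set of nodes with quark number at least `k`, then the minimum
degree of `H|_U` is at least `k`, and the `k`-quarks are exactly the connectivity components
of `H|_U`, i.e., the maximal subsets of `U` whose induced hypergraph is connected. -/
theorem stmt_11 [Fintype V] [DecidableEq V] (E : Finset (Finset V)) (k : ℕ)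
    (U : Finset V) (hU : ∀ u : V, u ∈ U ↔ k ≤ quarkNum E u) :
    (∀ v ∈ U, k ≤ hdeg E U v) ∧
    ∀ S : Finset V, IsQuark E k S ↔
      (S ⊆ U ∧ ConnectedOn E S ∧
        ∀ T : Finset V, T ⊆ U → S ⊆ T → ConnectedOn E T → T = S) := by
  rcases Nat.eq_zero_or_pos k with rfl | hk
  · obtain rfl : U = Finset.univ := Finset.eq_univ_of_forall fun u => (hU u).2 (Nat.zero_le _)
    simp [IsQuark]
  have hsub {S : Finset V} (hS : ConnectedOn E S) (hd : ∀ v ∈ S, k ≤ hdeg E S v) : S ⊆ U := by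
    obtain ⟨Q, hSQ, hQ⟩ := exists_isQuark_superset hS hd
    exact fun u hu => (hU u).2 (hQ.le_quarkNum (hSQ hu))
  have hex (u : V) (hu : u ∈ U) : ∃ P : Finset V, u ∈ P ∧ ConnectedOn E P ∧
      ∀ v ∈ P, k ≤ hdeg E P v := by
    have hku := (hU u).1 hu
    obtain ⟨P, hP, huP⟩ := exists_isQuark_quarkNum (hk.trans_le hku).ne'
    exact ⟨P, huP, hP.1, fun v hv => hku.trans (hP.2.1 v hv)⟩
  choose! P hmem hconn hdeg_P using hex
  have hattach {T : Finset V} (hTU : T ⊆ U) (hT : ConnectedOn E T) :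
      T ⊆ T.biUnion P ∧ ConnectedOn E (T.biUnion P) ∧
        ∀ v ∈ T.biUnion P, k ≤ hdeg E (T.biUnion P) v := by
    refine ⟨fun t ht => Finset.mem_biUnion.2 ⟨t, ht, hmem t (hTU ht)⟩,
      hT.biUnion (fun t ht => hmem t (hTU ht)) (fun t ht => hconn t (hTU ht)), ?_⟩
    intro v hv
    obtain ⟨t, ht, hvt⟩ := Finset.mem_biUnion.1 hv
    exact (hdeg_P t (hTU ht) v hvt).trans (hdeg_mono (Finset.subset_biUnion_of_mem P ht) v)
  refine ⟨fun v hv => (hdeg_P v hv v (hmem v hv)).trans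
    (hdeg_mono (hsub (hconn v hv) (hdeg_P v hv)) v), fun S => ⟨?_, ?_⟩⟩
  · rintro ⟨hS, hd, hmax⟩
    refine ⟨hsub hS hd, hS, fun T hTU hST hT => ?_⟩
    obtain ⟨hTW, hW, hdW⟩ := hattach hTU hT
    exact (hTW.trans (hmax _ (hST.trans hTW) hW hdW).subset).antisymm hST
  · rintro ⟨hSU, hS, hmax⟩
    obtain ⟨hSW, hW, hdW⟩ := hattach hSU hS
    rw [hmax _ (hsub hW hdW) hSW hW] at hdW
    exact ⟨hS, hdW, fun T hST hT hdT => hmax T (hsub hT hdT) hST hT⟩
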